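/- Monotone growth of reputation and demand under full-fill dynamics: For every advertisement sequence A : {1,…,N} → [0,1] and every initial reputation R_1 ∈ [0,1], the full-fill trajectories satisfy R_{i+1} ≥ R_i, R'_{i+1} ≥ R'_i, and D(R'_{i+1}) ≥ D(R'_i) for every i with 1 ≤ i ≤ N−1; moreover R_i ∈ [0,1] and R'_i ∈ [0,1] for all i. -/

import Mathlib

noncomputable section

/-- Post-advertisement reputation map. -/
def frep (α R a : ℝ) : ℝ := R + (1 - R) * a ^ α

/-- Demand function. -/
def dem (Λ q x : ℝ) : ℝ := if 0 < x then max 0 (Λ * (1 - q / x)) else 0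

/-- Full-fill reputation trajectory (0-indexed periods). -/
def rep (α w Λ q : ℝ) (A : ℕ → ℝ) (R1 : ℝ) : ℕ → ℝ
  | 0 => R1
  | i + 1 =>
      let R' := frep α (rep α w Λ q A R1 i) (A i)
      if 0 < dem Λ q R' then (1 - w) * R' + w else R'

/-- Full-fill total profit over horizon `N`. -/
def profit (α w Λ q p c cA : ℝ) (A : ℕ → ℝ) (R1 : ℝ) (N : ℕ) : ℝ :=
  ∑ i ∈ Finset.range N,
    ((p - c) * dem Λ q (frep α (rep α w Λ q A R1 i) (A i)) - cA * A i)


theorem aux_frep (α R a : ℝ) (hα : 0 < α) (h0 : 0 ≤ a) (h1 : a ≤ 1) (hR : R ≤ 1) :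
    R ≤ frep α R a ∧ frep α R a ≤ 1 := by
  have e0 : 0 ≤ a ^ α := Real.rpow_nonneg h0 α
  have e1 : a ^ α ≤ 1 := Real.rpow_le_one h0 h1 hα.le
  unfold frep
  constructor <;> nlinarith

theorem aux_dem (Λ q x y : ℝ) (hΛ : 0 < Λ) (hq : 0 ≤ q) (h : x ≤ y) :
    dem Λ q x ≤ dem Λ q y := by
  unfold dem
  by_cases hx : 0 < x
  · rw [if_pos hx, if_pos (hx.trans_le h)]
    have : q / y ≤ q / x := div_le_div_of_nonneg_left hq hx h
    exact max_le_max le_rfl (mul_le_mul_of_nonneg_left (by linarith) hΛ.le)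
  · rw [if_neg hx]
    split_ifs
    · exact le_max_left _ _
    · exact le_rfl

theorem aux_step (α w Λ q R1 : ℝ) (A : ℕ → ℝ) (i : ℕ) (hw0 : 0 ≤ w) (hw1 : w ≤ 1)
    (h : frep α (rep α w Λ q A R1 i) (A i) ≤ 1) :
    frep α (rep α w Λ q A R1 i) (A i) ≤ rep α w Λ q A R1 (i + 1) ∧
      rep α w Λ q A R1 (i + 1) ≤ 1 := by
  simp only [rep]
  split_ifs
  · constructor <;> nlinarith
  · exact ⟨le_rfl, h⟩

/-- Monotone growth of reputation and demand under full-fill dynamics. -/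
theorem full_fill_monotone_growth
    (Λ m u p α w R1 q : ℝ) (N : ℕ)
    (hΛ : 0 < Λ) (hm : 0 < m) (hu : 0 ≤ u) (hp : 0 < p)
    (hqdef : q = (u + p) / m) (hq1 : q < 1)
    (hα : 0 < α) (hw0 : 0 ≤ w) (hw1 : w ≤ 1)
    (A : ℕ → ℝ) (hA : ∀ i, 0 ≤ A i ∧ A i ≤ 1)
    (hR10 : 0 ≤ R1) (hR11 : R1 ≤ 1) :
    (∀ i, i + 2 ≤ N →
      rep α w Λ q A R1 i ≤ rep α w Λ q A R1 (i + 1) ∧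
      frep α (rep α w Λ q A R1 i) (A i) ≤
        frep α (rep α w Λ q A R1 (i + 1)) (A (i + 1)) ∧
      dem Λ q (frep α (rep α w Λ q A R1 i) (A i)) ≤
        dem Λ q (frep α (rep α w Λ q A R1 (i + 1)) (A (i + 1)))) ∧
    (∀ i, i + 1 ≤ N →
      0 ≤ rep α w Λ q A R1 i ∧ rep α w Λ q A R1 i ≤ 1 ∧
      0 ≤ frep α (rep α w Λ q A R1 i) (A i) ∧
      frep α (rep α w Λ q A R1 i) (A i) ≤ 1) := by
  have hq : 0 ≤ q := by rw [hqdef]; positivity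
  have hb : ∀ i, 0 ≤ rep α w Λ q A R1 i ∧ rep α w Λ q A R1 i ≤ 1 := by
    intro i
    induction i with
    | zero => exact ⟨hR10, hR11⟩
    | succ k ih =>
      have h1 := aux_frep α _ (A k) hα (hA k).1 (hA k).2 ih.2
      have h2 := aux_step α w Λ q R1 A k hw0 hw1 h1.2
      exact ⟨ih.1.trans (h1.1.trans h2.1), h2.2⟩
  have hf := fun i => aux_frep α _ (A i) hα (hA i).1 (hA i).2 (hb i).2
  have hs := fun i => aux_step α w Λ q R1 A i hw0 hw1 (hf i).2
  refine ⟨fun i _ => ?_, fun i _ =>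
    ⟨(hb i).1, (hb i).2, (hb i).1.trans (hf i).1, (hf i).2⟩⟩
  have h3 := (hs i).1.trans (hf (i + 1)).1
  exact ⟨(hf i).1.trans (hs i).1, h3, aux_dem Λ q _ _ hΛ hq h3⟩
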